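/- Under the hypotheses of the RK-RRK convergence theorem (A ∈ ℝ^{m×ℓ}, B ∈ ℝ^{ℓ×n}, rank(A) = rank(B) = ℓ, b ∈ ran(AB), f : ℝ^n → ℝ γ-strongly convex with differentiable conjugate, x⋆ the unique solution of: minimize f(x) subject to ABx = b, and ν > 0 with D_{f,z}(x, x⋆) ≤ (1/ν)‖B(x − x⋆)‖₂² for all x and z ∈ ∂f(x) ∩ ran(Bᵀ)), set α = 1 − σ_min²(A)/‖A‖_F², β = 1 − γν/(2‖B‖_F²), and ρ = max{α, β}. Then for every δ > 0 with (1 + δ/γ)ρ < 1 and every k ≥ 1, the RK-RRK iterates satisfy E[D_{f,z^{(k)}}(x^{(k)}, x⋆)] ≤ (1 + δ/γ)^k ρ^k ( D_{f,z^{(0)}}(x^{(0)}, x⋆) + ((δ+γ)γ²/(2δ²‖B‖_F²)) ‖A†b‖₂² ). -/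

import Mathlib

open Finset

noncomputable section

/-- Euclidean inner product on `ℝ^k`. -/
def dotp {k : ℕ} (x y : Fin k → ℝ) : ℝ := ∑ i, x i * y i

/-- Squared Euclidean norm on `ℝ^k`. -/
def sqnorm {k : ℕ} (x : Fin k → ℝ) : ℝ := ∑ i, (x i) ^ 2

/-- Subdifferential of `f` at `x`. -/
def subdiff {k : ℕ} (f : (Fin k → ℝ) → ℝ) (x : Fin k → ℝ) : Set (Fin k → ℝ) :=
  {z | ∀ y, f y ≥ f x + dotp z (y - x)}

/-- `f` is `γ`-strongly convex. -/
def StrongConvexWith {k : ℕ} (γ : ℝ) (f : (Fin k → ℝ) → ℝ) : Prop :=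
  ∀ x y z, z ∈ subdiff f x → f y ≥ f x + dotp z (y - x) + γ / 2 * sqnorm (y - x)

/-- Bregman distance between `x` and `y` with respect to `f` and `z ∈ ∂f(x)`. -/
def Dbreg {k : ℕ} (f : (Fin k → ℝ) → ℝ) (z x y : Fin k → ℝ) : ℝ :=
  f y - f x - dotp z (y - x)

open Matrix

/-- Squared Frobenius norm of a matrix. -/
def frobSq {m l : ℕ} (A : Matrix (Fin m) (Fin l) ℝ) : ℝ := ∑ i, ∑ j, (A i j) ^ 2

/-- Square of the minimum singular value of a (full column rank) matrix. -/
def sminSq {m l : ℕ} (A : Matrix (Fin m) (Fin l) ℝ) : ℝ :=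
  sInf {c : ℝ | ∃ v : Fin l → ℝ, sqnorm v = 1 ∧ c = sqnorm (A.mulVec v)}

/-- `P` is the Moore–Penrose pseudoinverse of `A` (Penrose conditions). -/
def IsMoorePenrose {m l : ℕ} (A : Matrix (Fin m) (Fin l) ℝ)
    (P : Matrix (Fin l) (Fin m) ℝ) : Prop :=
  A * P * A = A ∧ P * A * P = P ∧ (A * P)ᵀ = A * P ∧ (P * A)ᵀ = P * A

/-- One step of the RK-RRK algorithm: given the choice `c = (j, i)` of a row of `A`
and a row of `B`, and the current state `s = (y, z)`, perform one RK step for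
`A y = b` followed by one RRK step for `B x = y` (with `x = Df z`). -/
def rkrrkStep {m l n : ℕ} (A : Matrix (Fin m) (Fin l) ℝ) (B : Matrix (Fin l) (Fin n) ℝ)
    (b : Fin m → ℝ) (γ : ℝ) (Df : (Fin n → ℝ) → (Fin n → ℝ)) (c : Fin m × Fin l)
    (s : (Fin l → ℝ) × (Fin n → ℝ)) : (Fin l → ℝ) × (Fin n → ℝ) :=
  let y' := s.1 - ((dotp (A c.1) s.1 - b c.1) / sqnorm (A c.1)) • A c.1
  (y', s.2 - (γ * (dotp (B c.2) (Df s.2) - y' c.2) / sqnorm (B c.2)) • B c.2)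

/-- The RK-RRK iterate obtained from initial state `(y0, z0)` by applying one
step for each entry of the list of index choices. -/
def rkrrkIter {m l n : ℕ} (A : Matrix (Fin m) (Fin l) ℝ) (B : Matrix (Fin l) (Fin n) ℝ)
    (b : Fin m → ℝ) (γ : ℝ) (Df : (Fin n → ℝ) → (Fin n → ℝ))
    (y0 : Fin l → ℝ) (z0 : Fin n → ℝ) :
    List (Fin m × Fin l) → (Fin l → ℝ) × (Fin n → ℝ)
  | [] => (y0, z0)
  | c :: cs => rkrrkStep A B b γ Df c (rkrrkIter A B b γ Df y0 z0 cs)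
lemma dotp_eq_dotProduct {k : ℕ} (x y : Fin k → ℝ) : dotp x y = x ⬝ᵥ y := rfl

lemma sqnorm_eq_dotProduct {k : ℕ} (x : Fin k → ℝ) : sqnorm x = x ⬝ᵥ x := by
  simp [sqnorm, dotProduct, sq]

lemma sqnorm_nonneg {k : ℕ} (x : Fin k → ℝ) : 0 ≤ sqnorm x :=
  Finset.sum_nonneg fun _ _ => sq_nonneg _

lemma sqnorm_eq_zero {k : ℕ} {x : Fin k → ℝ} : sqnorm x = 0 ↔ x = 0 := by
  rw [sqnorm_eq_dotProduct, dotProduct_self_eq_zero]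

lemma sqnorm_smul {k : ℕ} (c : ℝ) (x : Fin k → ℝ) : sqnorm (c • x) = c ^ 2 * sqnorm x := by
  simp [sqnorm, mul_pow, Finset.mul_sum]

lemma sqnorm_neg {k : ℕ} (x : Fin k → ℝ) : sqnorm (-x) = sqnorm x := by
  simp [sqnorm]

lemma frobSq_eq_sum_sqnorm {m l : ℕ} (A : Matrix (Fin m) (Fin l) ℝ) :
    frobSq A = ∑ i, sqnorm (A i) := rfl

lemma frobSq_nonneg {m l : ℕ} (A : Matrix (Fin m) (Fin l) ℝ) : 0 ≤ frobSq A :=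
  Finset.sum_nonneg fun _ _ => sqnorm_nonneg _

lemma frobSq_pos {m l : ℕ} {A : Matrix (Fin m) (Fin l) ℝ} (hA : A ≠ 0) : 0 < frobSq A := by
  refine (frobSq_nonneg A).lt_of_ne fun h => hA ?_
  rw [frobSq_eq_sum_sqnorm, eq_comm,
    Finset.sum_eq_zero_iff_of_nonneg fun i _ => sqnorm_nonneg (A i)] at h
  ext i j
  exact congrFun (sqnorm_eq_zero.1 (h i (Finset.mem_univ i))) j

lemma sum_sqnorm_div_frobSq {m l : ℕ} {A : Matrix (Fin m) (Fin l) ℝ} (hA : A ≠ 0) :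
    ∑ i, sqnorm (A i) / frobSq A = 1 := by
  rw [← Finset.sum_div, ← frobSq_eq_sum_sqnorm, div_self (frobSq_pos hA).ne']

lemma bddBelow_sqnorm_mulVec {m l : ℕ} (A : Matrix (Fin m) (Fin l) ℝ) :
    BddBelow {c : ℝ | ∃ v : Fin l → ℝ, sqnorm v = 1 ∧ c = sqnorm (A.mulVec v)} :=
  ⟨0, by rintro _ ⟨v, -, rfl⟩; exact sqnorm_nonneg _⟩

lemma sminSq_mul_sqnorm_le {m l : ℕ} (A : Matrix (Fin m) (Fin l) ℝ) (v : Fin l → ℝ) :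
    sminSq A * sqnorm v ≤ sqnorm (A.mulVec v) := by
  rcases (sqnorm_nonneg v).eq_or_lt with h | h
  · rw [← h, mul_zero]
    exact sqnorm_nonneg _
  · have key : sminSq A ≤ sqnorm (A.mulVec ((√(sqnorm v))⁻¹ • v)) :=
      csInf_le (bddBelow_sqnorm_mulVec A)
        ⟨_, by rw [sqnorm_smul, inv_pow, Real.sq_sqrt h.le, inv_mul_cancel₀ h.ne'], rfl⟩
    rwa [mulVec_smul, sqnorm_smul, inv_pow, Real.sq_sqrt h.le, inv_mul_eq_div,
      le_div_iff₀ h] at key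

lemma sminSq_le_frobSq {m l : ℕ} (A : Matrix (Fin m) (Fin l) ℝ) (j : Fin l) :
    sminSq A ≤ frobSq A := by
  refine (csInf_le (bddBelow_sqnorm_mulVec A) ⟨Pi.single j 1, ?_, rfl⟩).trans ?_
  · simp [sqnorm_eq_dotProduct]
  · simp only [mulVec_single_one]
    exact Finset.sum_le_sum fun i _ =>
      Finset.single_le_sum (f := fun j => A i j ^ 2) (fun _ _ => sq_nonneg _) (Finset.mem_univ j)

lemma IsMoorePenrose.mul_eq_one {m l : ℕ} {A : Matrix (Fin m) (Fin l) ℝ}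
    {P : Matrix (Fin l) (Fin m) ℝ} (hP : IsMoorePenrose A P) (hA : A.rank = l) : P * A = 1 := by
  have hinj : Function.Injective A.mulVec := by
    rw [mulVec_injective_iff, linearIndependent_iff_card_eq_finrank_span, Fintype.card_fin,
      Set.finrank, ← rank_eq_finrank_span_cols, hA]
  refine ext_of_mulVec_single fun j => hinj ?_
  rw [mulVec_mulVec, ← Matrix.mul_assoc, hP.1, one_mulVec]

/-- The randomized Kaczmarz projection onto a hyperplane containing `ystar`, weighted by the
squared row norm so that zero rows are covered. -/
lemma sqnorm_mul_sqnorm_kaczmarz {l : ℕ} (a y ystar : Fin l → ℝ) :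
    sqnorm a * sqnorm (y - ((dotp a y - dotp a ystar) / sqnorm a) • a - ystar) =
      sqnorm a * sqnorm (y - ystar) - dotp a (y - ystar) ^ 2 := by
  rcases eq_or_ne (sqnorm a) 0 with h | h
  · rw [sqnorm_eq_zero.1 h]
    simp [dotp, sqnorm]
  · have e : y - ((dotp a y - dotp a ystar) / sqnorm a) • a - ystar =
        (y - ystar) - (dotp a (y - ystar) / sqnorm a) • a := by
      simp only [dotp_eq_dotProduct, dotProduct_sub]
      abel
    rw [e]
    clear e
    set e := y - ystar
    have : sqnorm (e - (dotp a e / sqnorm a) • a) =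
        sqnorm e - 2 * (dotp a e / sqnorm a) * dotp a e + (dotp a e / sqnorm a) ^ 2 * sqnorm a := by
      simp only [sqnorm_eq_dotProduct, dotp_eq_dotProduct, sub_dotProduct, dotProduct_sub,
        smul_dotProduct, dotProduct_smul, smul_eq_mul, dotProduct_comm e a]
      ring
    rw [this]
    field_simp
    ring

lemma sum_sqnorm_kaczmarz_le {m l : ℕ} {A : Matrix (Fin m) (Fin l) ℝ} (hA : A ≠ 0)
    (y ystar : Fin l → ℝ) :
    ∑ j, sqnorm (A j) / frobSq A *
        sqnorm (y - ((dotp (A j) y - A.mulVec ystar j) / sqnorm (A j)) • A j - ystar) ≤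
      (1 - sminSq A / frobSq A) * sqnorm (y - ystar) := by
  have hF := frobSq_pos hA
  have h1 : ∀ j, sqnorm (A j) / frobSq A *
        sqnorm (y - ((dotp (A j) y - A.mulVec ystar j) / sqnorm (A j)) • A j - ystar) =
      (sqnorm (A j) * sqnorm (y - ystar) - A.mulVec (y - ystar) j ^ 2) / frobSq A := fun j => by
    rw [div_mul_eq_mul_div]
    exact congrArg (· / _) (sqnorm_mul_sqnorm_kaczmarz (A j) y ystar)
  simp_rw [h1]
  rw [← Finset.sum_div, Finset.sum_sub_distrib, ← Finset.sum_mul, ← frobSq_eq_sum_sqnorm,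
    div_le_iff₀ hF]
  have := sminSq_mul_sqnorm_le A (y - ystar)
  have h2 : (1 - sminSq A / frobSq A) * sqnorm (y - ystar) * frobSq A =
      frobSq A * sqnorm (y - ystar) - sminSq A * sqnorm (y - ystar) := by
    field_simp
  rw [h2]
  exact sub_le_sub_left this _

lemma Dbreg_nonneg {k : ℕ} {f : (Fin k → ℝ) → ℝ} {z x : Fin k → ℝ} (h : z ∈ subdiff f x)
    (y : Fin k → ℝ) : 0 ≤ Dbreg f z x y := by
  have := h y
  unfold Dbreg
  linarith

/-- Strong convexity makes the Bregman distance smooth in the dual variable. -/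
lemma StrongConvexWith.Dbreg_add_le {k : ℕ} {γ : ℝ} {f : (Fin k → ℝ) → ℝ} (hγ : 0 < γ)
    (hf : StrongConvexWith γ f) {z x : Fin k → ℝ} (hx : z ∈ subdiff f x) (w x' y : Fin k → ℝ) :
    Dbreg f (z + w) x' y ≤ Dbreg f z x y + dotp w (x - y) + sqnorm w / (2 * γ) := by
  have h1 := hf x x' z hx
  have h2 : 0 ≤ sqnorm (w - γ • (x' - x)) / (2 * γ) := div_nonneg (sqnorm_nonneg _) (by positivity)
  have h3 : sqnorm (w - γ • (x' - x)) / (2 * γ) =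
      sqnorm w / (2 * γ) - dotp w (x' - x) + γ / 2 * sqnorm (x' - x) := by
    have : sqnorm (w - γ • (x' - x)) =
        sqnorm w - 2 * γ * dotp w (x' - x) + γ ^ 2 * sqnorm (x' - x) := by
      simp only [sqnorm_eq_dotProduct, dotp_eq_dotProduct, sub_dotProduct, dotProduct_sub,
        smul_dotProduct, dotProduct_smul, smul_eq_mul, dotProduct_comm _ w, dotProduct_comm x' x]
      ring
    rw [this]
    field_simp
  rw [h3] at h2
  simp only [Dbreg, dotp_eq_dotProduct, add_dotProduct, dotProduct_sub] at *
  linarith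

/-- One Bregman–Kaczmarz step towards `⟨a, x⟩ = η`, weighted by the squared row norm. -/
lemma StrongConvexWith.sqnorm_mul_Dbreg_step_le {k : ℕ} {γ : ℝ} {f : (Fin k → ℝ) → ℝ}
    (hγ : 0 < γ) (hf : StrongConvexWith γ f) {z x : Fin k → ℝ} (hx : z ∈ subdiff f x)
    (a x' y : Fin k → ℝ) (η : ℝ) :
    sqnorm a * Dbreg f (z - (γ * (dotp a x - η) / sqnorm a) • a) x' y ≤
      sqnorm a * Dbreg f z x y + γ / 2 * ((η - dotp a y) ^ 2 - dotp a (x - y) ^ 2) := by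
  rcases eq_or_ne (sqnorm a) 0 with h | h
  · rw [sqnorm_eq_zero.1 h]
    simp only [sqnorm_eq_dotProduct, dotp_eq_dotProduct, zero_dotProduct, zero_mul, zero_add]
    have := sq_nonneg (η - 0)
    nlinarith
  · have hpos : 0 < sqnorm a := (sqnorm_nonneg a).lt_of_ne' h
    set t := γ * (dotp a x - η) / sqnorm a with ht
    have h1 := hf.Dbreg_add_le hγ hx (-(t • a)) x' y
    rw [← sub_eq_add_neg, sqnorm_neg, sqnorm_smul] at h1
    refine (mul_le_mul_of_nonneg_left h1 hpos.le).trans (le_of_eq ?_)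
    have h2 : dotp (-(t • a)) (x - y) = -(t * dotp a (x - y)) := by
      rw [dotp_eq_dotProduct, neg_dotProduct, smul_dotProduct, smul_eq_mul, dotp_eq_dotProduct]
    have h3 : dotp a (x - y) = dotp a x - dotp a y := by simp [dotp_eq_dotProduct]
    rw [h2, h3, ht]
    field_simp
    ring

lemma StrongConvexWith.sum_Dbreg_step_le {l n : ℕ} {B : Matrix (Fin l) (Fin n) ℝ} (hB : B ≠ 0)
    {γ : ℝ} {f : (Fin n → ℝ) → ℝ} (hγ : 0 < γ) (hf : StrongConvexWith γ f)
    {z x : Fin n → ℝ} (hx : z ∈ subdiff f x) (x' : Fin l → Fin n → ℝ)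
    (xstar : Fin n → ℝ) (y : Fin l → ℝ) :
    ∑ i, sqnorm (B i) / frobSq B *
        Dbreg f (z - (γ * (dotp (B i) x - y i) / sqnorm (B i)) • B i) (x' i) xstar ≤
      Dbreg f z x xstar + γ / (2 * frobSq B) *
        (sqnorm (y - B.mulVec xstar) - sqnorm (B.mulVec (x - xstar))) := by
  have hF := frobSq_pos hB
  have h1 : ∀ i, sqnorm (B i) / frobSq B *
        Dbreg f (z - (γ * (dotp (B i) x - y i) / sqnorm (B i)) • B i) (x' i) xstar ≤
      (sqnorm (B i) * Dbreg f z x xstar + γ / 2 *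
        ((y - B.mulVec xstar) i ^ 2 - B.mulVec (x - xstar) i ^ 2)) / frobSq B := fun i => by
    rw [div_mul_eq_mul_div]
    exact div_le_div_of_nonneg_right
      (hf.sqnorm_mul_Dbreg_step_le hγ hx (B i) (x' i) xstar (y i)) hF.le
  refine (Finset.sum_le_sum fun i _ => h1 i).trans (le_of_eq ?_)
  rw [← Finset.sum_div, Finset.sum_add_distrib, ← Finset.sum_mul, ← Finset.mul_sum,
    Finset.sum_sub_distrib, ← frobSq_eq_sum_sqnorm]
  unfold sqnorm
  field_simp

/-- The expectation over `k + 1` independent choices, conditioned on all but the head. -/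
lemma sum_prod_mul_ofFn_succ {ι : Type*} [Fintype ι] (p : ι → ℝ) (g : List ι → ℝ) (k : ℕ) :
    ∑ s : Fin (k + 1) → ι, (∏ t, p (s t)) * g (List.ofFn s) =
      ∑ s : Fin k → ι, (∏ t, p (s t)) * ∑ c, p c * g (c :: List.ofFn s) := by
  rw [← (Fin.consEquiv fun _ => ι).sum_comp, Fintype.sum_prod_type, Finset.sum_comm]
  refine Finset.sum_congr rfl fun s _ => ?_
  rw [Finset.mul_sum]
  refine Finset.sum_congr rfl fun c _ => ?_
  simp only [Fin.consEquiv_apply, Fin.prod_univ_succ, Fin.cons_zero, Fin.cons_succ,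
    List.ofFn_succ]
  ring

/-- A pair of nonnegative-weight recursions `E[U'] ≤ ρ U`, `E[V'] ≤ ρ V + q U` gives
`E[V_k] ≤ ρ ^ k V₀ + k q ρ ^ (k-1) U₀`, here with `q = c * ρ`. -/
lemma sum_prod_mul_le_of_coupled_recursion {ι : Type*} [Fintype ι] {p : ι → ℝ}
    (hp : ∀ c, 0 ≤ p c) {ρ c : ℝ} (hρ : 0 ≤ ρ) (hc : 0 ≤ c) {U V : List ι → ℝ}
    (hU : ∀ L, ∑ i, p i * U (i :: L) ≤ ρ * U L)
    (hV : ∀ L, ∑ i, p i * V (i :: L) ≤ ρ * V L + c * (ρ * U L)) (k : ℕ) :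
    ∑ s : Fin k → ι, (∏ t, p (s t)) * V (List.ofFn s) ≤ ρ ^ k * (V [] + k * c * U []) := by
  have hw : ∀ (k : ℕ) (s : Fin k → ι), 0 ≤ ∏ t, p (s t) :=
    fun k s => Finset.prod_nonneg fun _ _ => hp _
  have hUk : ∀ k : ℕ, ∑ s : Fin k → ι, (∏ t, p (s t)) * U (List.ofFn s) ≤ ρ ^ k * U [] := by
    intro k
    induction k with
    | zero => simp
    | succ k ih =>
      rw [sum_prod_mul_ofFn_succ]
      calc _ ≤ ∑ s : Fin k → ι, (∏ t, p (s t)) * (ρ * U (List.ofFn s)) :=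
            Finset.sum_le_sum fun s _ => mul_le_mul_of_nonneg_left (hU _) (hw k s)
        _ = ρ * ∑ s : Fin k → ι, (∏ t, p (s t)) * U (List.ofFn s) := by
            rw [Finset.mul_sum]
            exact Finset.sum_congr rfl fun s _ => by ring
        _ ≤ ρ * (ρ ^ k * U []) := mul_le_mul_of_nonneg_left ih hρ
        _ = _ := by ring
  induction k with
  | zero => simp
  | succ k ih =>
    rw [sum_prod_mul_ofFn_succ]
    calc _ ≤ ∑ s : Fin k → ι, (∏ t, p (s t)) *
              (ρ * V (List.ofFn s) + c * (ρ * U (List.ofFn s))) :=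
          Finset.sum_le_sum fun s _ => mul_le_mul_of_nonneg_left (hV _) (hw k s)
      _ = ρ * ∑ s : Fin k → ι, (∏ t, p (s t)) * V (List.ofFn s) +
            c * ρ * ∑ s : Fin k → ι, (∏ t, p (s t)) * U (List.ofFn s) := by
          rw [Finset.mul_sum, Finset.mul_sum, ← Finset.sum_add_distrib]
          exact Finset.sum_congr rfl fun s _ => by ring
      _ ≤ ρ * (ρ ^ k * (V [] + k * c * U [])) + c * ρ * (ρ ^ k * U []) :=
          add_le_add (mul_le_mul_of_nonneg_left ih hρ)
            (mul_le_mul_of_nonneg_left (hUk k) (mul_nonneg hc hρ))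
      _ = _ := by push_cast; ring

lemma rkrrkIter_snd_mem_range {m l n : ℕ} (A : Matrix (Fin m) (Fin l) ℝ)
    (B : Matrix (Fin l) (Fin n) ℝ) (b : Fin m → ℝ) (γ : ℝ) (Df : (Fin n → ℝ) → (Fin n → ℝ))
    (y0 : Fin l → ℝ) {z0 : Fin n → ℝ} (hz0 : z0 ∈ Set.range Bᵀ.mulVec) :
    ∀ L, (rkrrkIter A B b γ Df y0 z0 L).2 ∈ Set.range Bᵀ.mulVec
  | [] => hz0
  | c :: L => by
    obtain ⟨v, hv⟩ := rkrrkIter_snd_mem_range A B b γ Df y0 hz0 L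
    simp only [rkrrkIter, rkrrkStep, ← hv]
    generalize γ * _ / _ = t
    refine ⟨v - t • Pi.single c.2 1, ?_⟩
    rw [mulVec_sub, mulVec_smul, mulVec_single_one]
    rfl

/-- Linear convergence bound for RK-RRK (Remark 3.2, Bregman
distance form): with `ρ = max{α, β}` and `(1 + δ/γ)ρ < 1`, the expected Bregman
distance of the `k`-th RK-RRK iterate to `x⋆` is bounded by
`(1+δ/γ)^k ρ^k (D_{f,z⁰}(x⁰,x⋆) + ((δ+γ)γ²/(2δ²‖B‖_F²))‖A†b‖₂²)`. -/
theorem rk_rrk_linear_rate_bregman {m l n : ℕ}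
    (A : Matrix (Fin m) (Fin l) ℝ) (B : Matrix (Fin l) (Fin n) ℝ)
    (b : Fin m → ℝ) (Adag : Matrix (Fin l) (Fin m) ℝ)
    (hA : A.rank = l) (hB : B.rank = l) (hAdag : IsMoorePenrose A Adag)
    (hb : ∃ x, (A * B).mulVec x = b)
    (f : (Fin n → ℝ) → ℝ) (γ : ℝ) (hγ : 0 < γ) (hsc : StrongConvexWith γ f)
    (Df : (Fin n → ℝ) → (Fin n → ℝ)) (hDf : ∀ x z, z ∈ subdiff f x ↔ x = Df z)
    (xstar : Fin n → ℝ) (hfeas : (A * B).mulVec xstar = b)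
    (hmin : ∀ x, (A * B).mulVec x = b → f xstar ≤ f x)
    (ν : ℝ) (hν : 0 < ν)
    (hnu : ∀ x z, z ∈ subdiff f x → z ∈ Set.range Bᵀ.mulVec →
      Dbreg f z x xstar ≤ (1 / ν) * sqnorm (B.mulVec (x - xstar)))
    (z0 : Fin n → ℝ) (hz0 : z0 ∈ Set.range Bᵀ.mulVec)
    (δ : ℝ) (hδ : 0 < δ)
    (ρ : ℝ) (hρ : ρ = max (1 - sminSq A / frobSq A) (1 - γ * ν / (2 * frobSq B)))
    (hrate : (1 + δ / γ) * ρ < 1)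
    (k : ℕ) (hk : 1 ≤ k) :
    ∑ s : Fin k → Fin m × Fin l,
        (∏ t, (sqnorm (A (s t).1) / frobSq A) * (sqnorm (B (s t).2) / frobSq B)) *
          Dbreg f (rkrrkIter A B b γ Df 0 z0 (List.ofFn s)).2
            (Df (rkrrkIter A B b γ Df 0 z0 (List.ofFn s)).2) xstar
      ≤ (1 + δ / γ) ^ k * ρ ^ k *
          (Dbreg f z0 (Df z0) xstar +
            (δ + γ) * γ ^ 2 / (2 * δ ^ 2 * frobSq B) * sqnorm (Adag.mulVec b)) := by
  have hl : l ≠ 0 := by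
    rintro rfl
    have h0 : ∀ {m : ℕ} (A : Matrix (Fin 0) (Fin m) ℝ), frobSq A = 0 := fun A => by simp [frobSq]
    have h0' : frobSq A = 0 := by simp [frobSq]
    rw [hρ, h0, h0'] at hrate
    have : 0 < δ / γ := div_pos hδ hγ
    norm_num at hrate
    linarith
  have hA0 : A ≠ 0 := by
    rintro rfl
    exact hl (by simpa using hA.symm)
  have hB0 : B ≠ 0 := by
    rintro rfl
    exact hl (by simpa using hB.symm)
  have hFA := frobSq_pos hA0
  have hFB := frobSq_pos hB0
  have hρ0 : 0 ≤ ρ := by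
    rw [hρ]
    refine le_max_of_le_left (sub_nonneg.2 ((div_le_one hFA).2 ?_))
    exact sminSq_le_frobSq A ⟨0, Nat.pos_of_ne_zero hl⟩
  have hb' : b = A.mulVec (B.mulVec xstar) := by rw [mulVec_mulVec, hfeas]
  have hy : Adag.mulVec b = B.mulVec xstar := by
    rw [hb', mulVec_mulVec, hAdag.mul_eq_one hA, one_mulVec]
  have hmem : ∀ z, z ∈ subdiff f (Df z) := fun z => (hDf _ _).2 rfl
  have hpA : ∀ j, 0 ≤ sqnorm (A j) / frobSq A := fun j => div_nonneg (sqnorm_nonneg _) hFA.le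
  have hpB : ∀ i, 0 ≤ sqnorm (B i) / frobSq B := fun i => div_nonneg (sqnorm_nonneg _) hFB.le
  have hstepU : ∀ y, ∑ j, sqnorm (A j) / frobSq A *
      sqnorm (y - ((dotp (A j) y - b j) / sqnorm (A j)) • A j - B.mulVec xstar) ≤
      ρ * sqnorm (y - B.mulVec xstar) := fun y => by
    rw [hb']
    refine (sum_sqnorm_kaczmarz_le hA0 y _).trans ?_
    exact mul_le_mul_of_nonneg_right (hρ ▸ le_max_left _ _) (sqnorm_nonneg _)
  have hstepV : ∀ z ∈ Set.range Bᵀ.mulVec, ∀ y : Fin l → ℝ,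
      ∑ i, sqnorm (B i) / frobSq B *
        Dbreg f (z - (γ * (dotp (B i) (Df z) - y i) / sqnorm (B i)) • B i)
          (Df (z - (γ * (dotp (B i) (Df z) - y i) / sqnorm (B i)) • B i)) xstar ≤
      ρ * Dbreg f z (Df z) xstar + γ / (2 * frobSq B) * sqnorm (y - B.mulVec xstar) := by
    intro z hz y
    refine (hsc.sum_Dbreg_step_le hB0 hγ (hmem z) _ xstar y).trans ?_
    have h1 := hnu _ _ (hmem z) hz
    rw [one_div, inv_mul_eq_div, le_div_iff₀ hν] at h1
    have h2 := mul_le_mul_of_nonneg_left h1 (div_pos hγ (mul_pos two_pos hFB)).le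
    have h3 : (1 - γ * ν / (2 * frobSq B)) * Dbreg f z (Df z) xstar ≤
        ρ * Dbreg f z (Df z) xstar :=
      mul_le_mul_of_nonneg_right (hρ ▸ le_max_right _ _) (Dbreg_nonneg (hmem z) _)
    have h4 : γ / (2 * frobSq B) * (Dbreg f z (Df z) xstar * ν) =
        γ * ν / (2 * frobSq B) * Dbreg f z (Df z) xstar := by ring
    linarith
  set S := rkrrkIter A B b γ Df 0 z0
  have hcons : ∀ c L, S (c :: L) = rkrrkStep A B b γ Df c (S L) := fun _ _ => rfl
  have key := sum_prod_mul_le_of_coupled_recursion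
    (p := fun c : Fin m × Fin l => sqnorm (A c.1) / frobSq A * (sqnorm (B c.2) / frobSq B))
    (fun c => mul_nonneg (hpA _) (hpB _)) hρ0 (div_pos hγ (mul_pos two_pos hFB)).le
    (U := fun L => sqnorm ((S L).1 - B.mulVec xstar))
    (V := fun L => Dbreg f (S L).2 (Df (S L).2) xstar)
    (fun L => by
      simp only [hcons, rkrrkStep]
      rw [Fintype.sum_prod_type]
      simp only [mul_right_comm _ (sqnorm (B _) / frobSq B)]
      simp_rw [← Finset.mul_sum, sum_sqnorm_div_frobSq hB0, mul_one]
      exact hstepU _)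
    (fun L => by
      have hz : (S L).2 ∈ Set.range Bᵀ.mulVec := rkrrkIter_snd_mem_range A B b γ Df 0 hz0 L
      simp only [hcons, rkrrkStep]
      rw [Fintype.sum_prod_type]
      simp_rw [mul_assoc, ← Finset.mul_sum]
      refine (Finset.sum_le_sum fun j _ =>
        mul_le_mul_of_nonneg_left (hstepV _ hz _) (hpA j)).trans ?_
      simp_rw [mul_add, Finset.sum_add_distrib, ← Finset.sum_mul, sum_sqnorm_div_frobSq hA0,
        one_mul, mul_left_comm _ (γ / (2 * frobSq B)), ← Finset.mul_sum]
      have := mul_le_mul_of_nonneg_left (hstepU (S L).1) (div_pos hγ (mul_pos two_pos hFB)).le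
      linarith) k
  refine key.trans ?_
  have hU0 : sqnorm ((S []).1 - B.mulVec xstar) = sqnorm (B.mulVec xstar) := by
    rw [show (S []).1 = 0 from rfl, zero_sub, sqnorm_neg]
  have hV0 : Dbreg f (S []).2 (Df (S []).2) xstar = Dbreg f z0 (Df z0) xstar := rfl
  simp only [hU0, hV0, hy]
  rw [mul_comm ((1 + δ / γ) ^ k), mul_assoc (ρ ^ k)]
  refine mul_le_mul_of_nonneg_left ?_ (pow_nonneg hρ0 k)
  have hdg : 0 < δ / γ := div_pos hδ hγ
  have hbern : 1 + k * (δ / γ) ≤ (1 + δ / γ) ^ k :=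
    one_add_mul_le_pow (by linarith) k
  have hk' : (k : ℝ) ≤ (1 + δ / γ) ^ k * (γ / δ) := by
    have : (k : ℝ) = k * (δ / γ) * (γ / δ) := by field_simp
    rw [this]
    exact mul_le_mul_of_nonneg_right (by linarith) (by positivity)
  have hone : 1 ≤ (1 + δ / γ) ^ k := one_le_pow₀ (by linarith)
  have hD := Dbreg_nonneg (hmem z0) xstar
  have hN := sqnorm_nonneg (B.mulVec xstar)
  have hcoef : γ / δ * (γ / (2 * frobSq B)) ≤ (δ + γ) * γ ^ 2 / (2 * δ ^ 2 * frobSq B) := by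
    have : (δ + γ) * γ ^ 2 / (2 * δ ^ 2 * frobSq B) =
        γ / δ * (γ / (2 * frobSq B)) + γ ^ 3 / (2 * δ ^ 2 * frobSq B) := by
      field_simp
    rw [this]
    exact le_add_of_nonneg_right (by positivity)
  rw [mul_add]
  refine add_le_add (le_mul_of_one_le_left hD hone) ?_
  rw [← mul_assoc]
  refine mul_le_mul_of_nonneg_right ?_ hN
  calc (k : ℝ) * (γ / (2 * frobSq B))
      ≤ (1 + δ / γ) ^ k * (γ / δ) * (γ / (2 * frobSq B)) :=
        mul_le_mul_of_nonneg_right hk' (by positivity)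
    _ = (1 + δ / γ) ^ k * (γ / δ * (γ / (2 * frobSq B))) := mul_assoc _ _ _
    _ ≤ _ := mul_le_mul_of_nonneg_left hcoef (by positivity)

end
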